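/- Let Θ ⊆ ℝ be open, θ₀ ∈ Θ, and let θ ↦ ρ(θ) be a family of density matrices on ℂ^d whose matrix entries are differentiable at θ₀, with entrywise derivative ρ̇ at θ₀. Let λ be a Hermitian matrix with ρ̇ = (1/2)(λρ(θ₀) + ρ(θ₀)λ) and suppose I_Q = trace(ρ(θ₀)λ²) > 0. Let (m x)_{x∈X} be a POVM with finite outcome set X, set p(x;θ) = trace(ρ(θ) · m x), and let t : X → ℝ be an estimator that is unbiased near θ₀, i.e. ∑_{x∈X} t(x) p(x;θ) = θ for all θ in some neighborhood of θ₀. Then the variance of the estimator at θ₀ satisfies the quantum Cramér–Rao bound: ∑_{x∈X} (t(x) − θ₀)² p(x;θ₀) ≥ 1 / I_Q. -/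

import Mathlib

open Matrix BigOperators
open scoped ComplexOrder

/-- The trace of a product of two positive semidefinite matrices has nonnegative real part. -/
theorem qcr_trace_mul_nonneg {d : ℕ} (A B : Matrix (Fin d) (Fin d) ℂ)
    (hA : A.PosSemidef) (hB : B.PosSemidef) : 0 ≤ ((A * B).trace).re := by
  obtain ⟨C, rfl⟩ : ∃ C : Matrix (Fin d) (Fin d) ℂ, A = Cᴴ * C := by
    open scoped MatrixOrder in
    exact CStarAlgebra.nonneg_iff_eq_star_mul_self.mp hA.nonneg
  have h := (hB.mul_mul_conjTranspose_same C).trace_nonneg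
  rw [Matrix.trace_mul_comm, ← Matrix.mul_assoc] at h
  exact (Complex.le_def.mp h).1

theorem qcr_deriv {d : ℕ} (ρ : ℝ → Matrix (Fin d) (Fin d) ℂ)
    (ρdot : Matrix (Fin d) (Fin d) ℂ) (θ₀ : ℝ)
    (hderiv : ∀ i j, HasDerivAt (fun θ => ρ θ i j) (ρdot i j) θ₀)
    (M : Matrix (Fin d) (Fin d) ℂ) :
    HasDerivAt (fun θ => ((ρ θ * M).trace).re) ((ρdot * M).trace).re θ₀ := by
  have h : HasDerivAt (fun θ => (ρ θ * M).trace) (ρdot * M).trace θ₀ := by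
    simp only [Matrix.trace, Matrix.diag, Matrix.mul_apply]
    exact HasDerivAt.fun_sum fun i _ => HasDerivAt.fun_sum fun j _ =>
      (hderiv i j).mul_const (M j i)
  exact (Complex.reCLM.hasFDerivAt.comp_hasDerivAt θ₀ h)

theorem qcr_expand {d : ℕ} (R L M : Matrix (Fin d) (Fin d) ℂ) (s a : ℝ) :
    ((R * (((s : ℂ) • (1 : Matrix (Fin d) (Fin d) ℂ) - (a : ℂ) • L) * M *
      ((s : ℂ) • (1 : Matrix (Fin d) (Fin d) ℂ) - (a : ℂ) • L))).trace).re =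
    s ^ 2 * ((R * M).trace).re
      - 2 * a * (s * ((((1 / 2 : ℂ) • (L * R + R * L)) * M).trace).re)
      + a ^ 2 * ((L * R * L * M).trace).re := by
  have e1 : (R * (M * L)).trace = (L * (R * M)).trace := by
    rw [← Matrix.mul_assoc, Matrix.trace_mul_comm]
  have e2 : (R * (L * (M * L))).trace = (L * (R * (L * M))).trace := by
    rw [← Matrix.mul_assoc, ← Matrix.mul_assoc, Matrix.trace_mul_comm, Matrix.mul_assoc R]
  have key : (R * (((s : ℂ) • (1 : Matrix (Fin d) (Fin d) ℂ) - (a : ℂ) • L) * M *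
      ((s : ℂ) • (1 : Matrix (Fin d) (Fin d) ℂ) - (a : ℂ) • L))).trace =
      ((s ^ 2 : ℝ) : ℂ) * (R * M).trace
      - ((2 * a * s : ℝ) : ℂ) * (((1 / 2 : ℂ) • (L * R + R * L)) * M).trace
      + ((a ^ 2 : ℝ) : ℂ) * (L * R * L * M).trace := by
    simp only [sub_mul, mul_sub, smul_mul_assoc, mul_smul_comm, one_mul, mul_one, add_mul,
      Matrix.trace_sub, Matrix.trace_add, Matrix.trace_smul, smul_eq_mul, Matrix.mul_assoc,
      e1, e2]
    push_cast
    ring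
  rw [key]
  simp only [Complex.add_re, Complex.sub_re, Complex.re_ofReal_mul]
  ring

/-- Quantum Cramér–Rao bound (Helstrom): the variance of any unbiased estimator
based on the outcome of any POVM measurement is at least the inverse of the
quantum Fisher information. -/
theorem quantum_cramer_rao
    {d : ℕ} {X : Type*} [Fintype X]
    (Θ : Set ℝ) (hΘ : IsOpen Θ) (θ₀ : ℝ) (hθ₀ : θ₀ ∈ Θ)
    (ρ : ℝ → Matrix (Fin d) (Fin d) ℂ)
    (hρ : ∀ θ ∈ Θ, (ρ θ).PosSemidef ∧ (ρ θ).trace = 1)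
    (ρdot : Matrix (Fin d) (Fin d) ℂ)
    (hderiv : ∀ i j, HasDerivAt (fun θ => ρ θ i j) (ρdot i j) θ₀)
    (lam : Matrix (Fin d) (Fin d) ℂ) (hlam : lam.IsHermitian)
    (hscore : ρdot = (1 / 2 : ℂ) • (lam * ρ θ₀ + ρ θ₀ * lam))
    (IQ : ℝ) (hIQ : IQ = ((ρ θ₀ * lam ^ 2).trace).re) (hIQpos : 0 < IQ)
    (m : X → Matrix (Fin d) (Fin d) ℂ)
    (hm : ∀ x, (m x).PosSemidef) (hmsum : ∑ x, m x = 1)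
    (p : X → ℝ → ℝ) (hp : ∀ x θ, p x θ = ((ρ θ * m x).trace).re)
    (t : X → ℝ)
    (hunbiased : ∀ᶠ θ in nhds θ₀, ∑ x, t x * p x θ = θ) :
    ∑ x, (t x - θ₀) ^ 2 * p x θ₀ ≥ 1 / IQ := by
  have hd := fun x => qcr_deriv ρ ρdot θ₀ hderiv (m x)
  -- derivative of the unbiasedness identity
  have h1 : ∑ x, t x * ((ρdot * m x).trace).re = 1 := by
    have hA : HasDerivAt (fun θ => ∑ x, t x * p x θ)
        (∑ x, t x * ((ρdot * m x).trace).re) θ₀ := by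
      simp only [hp]
      exact HasDerivAt.fun_sum fun x _ => (hd x).const_mul (t x)
    exact hA.unique ((hasDerivAt_id' θ₀).congr_of_eventuallyEq hunbiased)
  -- derivative of the normalization
  have h0 : ∑ x, ((ρdot * m x).trace).re = 0 := by
    have hs : ∀ A : Matrix (Fin d) (Fin d) ℂ,
        ∑ x, ((A * m x).trace).re = ((A * 1).trace).re := by
      intro A
      rw [← hmsum, Finset.mul_sum, Matrix.trace_sum, Complex.re_sum]
    have hA := qcr_deriv ρ ρdot θ₀ hderiv 1
    rw [hs]
    refine hA.unique ((hasDerivAt_const θ₀ (1 : ℝ)).congr_of_eventuallyEq ?_)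
    filter_upwards [hΘ.mem_nhds hθ₀] with θ hθ
    simp [(hρ θ hθ).2]
  have h2 : ∑ x, (t x - θ₀) * ((ρdot * m x).trace).re = 1 := by
    simp only [sub_mul, Finset.sum_sub_distrib, ← Finset.mul_sum, h1, h0]
    ring
  have h3 : ∑ x, ((lam * ρ θ₀ * lam * m x).trace).re = IQ := by
    rw [← Complex.re_sum, ← Matrix.trace_sum, ← Finset.mul_sum, hmsum, mul_one, hIQ,
      Matrix.mul_assoc, Matrix.trace_mul_comm, pow_two, Matrix.mul_assoc]
  have hq : ∀ a : ℝ, 0 ≤ ∑ x, (t x - θ₀) ^ 2 * p x θ₀ - 2 * a * 1 + a ^ 2 * IQ := by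
    intro a
    rw [← h3, ← h2, Finset.mul_sum, Finset.mul_sum, ← Finset.sum_sub_distrib,
      ← Finset.sum_add_distrib]
    refine Finset.sum_nonneg fun x _ => ?_
    rw [hp, hscore, ← qcr_expand]
    refine qcr_trace_mul_nonneg _ _ (hρ θ₀ hθ₀).1 ?_
    have hB : (((t x - θ₀ : ℝ) : ℂ) • (1 : Matrix (Fin d) (Fin d) ℂ) - (a : ℂ) • lam)ᴴ =
        ((t x - θ₀ : ℝ) : ℂ) • (1 : Matrix (Fin d) (Fin d) ℂ) - (a : ℂ) • lam := by
      rw [Matrix.conjTranspose_sub, Matrix.conjTranspose_smul, Matrix.conjTranspose_smul,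
        hlam.eq, Matrix.conjTranspose_one, Complex.star_def, Complex.conj_ofReal,
        Complex.conj_ofReal]
    have h := (hm x).mul_mul_conjTranspose_same
      (((t x - θ₀ : ℝ) : ℂ) • (1 : Matrix (Fin d) (Fin d) ℂ) - (a : ℂ) • lam)
    rwa [hB] at h
  have h := hq (1 / IQ)
  have e : (1 / IQ) ^ 2 * IQ = 1 / IQ := by field_simp
  rw [e] at h
  linarith
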